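/- Let K be a field, n ≥ 1, d ≥ 0, and let M = M₀ + M₁ be a uniform determinantal representation of p_{n,d} of size N such that some nonzero vector u ∈ Kᴺ satisfies uᵀM₀ = 0 identically as a row vector of polynomials. Then N·(n+1) − (N−1) ≥ binom(n+d, n); equivalently N·n + 1 ≥ binom(n+d, n), so N ≥ (binom(n+d,n) − 1)/n. -/

import Mathlib

open MvPolynomial

/-- Exponent vectors in `n` variables of total degree at most `d`. -/
def ExpLE (n d : ℕ) : Type := {α : Fin n →₀ ℕ // (α.sum fun _ e => e) ≤ d}

noncomputable instance (n d : ℕ) : Fintype (ExpLE n d) := by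
  have key : ∀ α : ExpLE n d, ∀ i, α.1 i < d + 1 := by
    intro α i
    refine Nat.lt_succ_of_le (le_trans ?_ α.2)
    by_cases h : α.1 i = 0
    · simp [h]
    · rw [Finsupp.sum]
      exact Finset.single_le_sum (f := fun j => α.1 j) (fun _ _ => Nat.zero_le _)
        (Finsupp.mem_support_iff.mpr h)
  exact Fintype.ofInjective (fun α : ExpLE n d => fun i => (⟨α.1 i, key α i⟩ : Fin (d+1)))
    (fun α β h => Subtype.ext (Finsupp.ext fun i => congrArg Fin.val (congrFun h i)))

instance (n d : ℕ) : DecidableEq (ExpLE n d) := by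
  unfold ExpLE; infer_instance

/-- The ring `R = K[x₁,…,xₙ,(c_α)_{|α|≤d}]`. -/
abbrev URing (K : Type*) [Field K] (n d : ℕ) := MvPolynomial (Fin n ⊕ ExpLE n d) K

/-- The generic polynomial `p_{n,d} = Σ_{|α|≤d} c_α x^α`. -/
noncomputable def genPoly (K : Type*) [Field K] (n d : ℕ) : URing K n d :=
  ∑ α : ExpLE n d, X (Sum.inr α) * ∏ i : Fin n, X (Sum.inl i) ^ (α.1 i)

/-- The monomials `1, xᵢ, c_α, c_α xᵢ`. -/
def allowedMonomials (K : Type*) [Field K] (n d : ℕ) : Set (URing K n d) :=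
  {1} ∪ (Set.range fun i : Fin n => (X (Sum.inl i) : URing K n d))
    ∪ (Set.range fun α : ExpLE n d => (X (Sum.inr α) : URing K n d))
    ∪ (Set.range fun p : ExpLE n d × Fin n =>
        (X (Sum.inr p.1) * X (Sum.inl p.2) : URing K n d))

/-- A uniform determinantal representation of `p_{n,d}` of size `N`. -/
def IsUDR (K : Type*) [Field K] (n d N : ℕ)
    (M : Matrix (Fin N) (Fin N) (URing K n d)) : Prop :=
  (∀ i j, M i j ∈ Submodule.span K (allowedMonomials K n d)) ∧
    M.det = genPoly K n d

/-- `N*(n,d)`: the minimal size of a uniform determinantal representation. -/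
noncomputable def Nstar (K : Type*) [Field K] (n d : ℕ) : ℕ :=
  sInf {N : ℕ | ∃ M : Matrix (Fin N) (Fin N) (URing K n d), IsUDR K n d N M}

/-- Setting all the `c_α` to zero: `M ↦ M₀` entrywise. -/
noncomputable def killC (K : Type*) [Field K] (n d : ℕ) :
    URing K n d →ₐ[K] MvPolynomial (Fin n) K :=
  aeval (Sum.elim X fun _ => 0)

/-- A subspace `V ⊆ K[x₁,…,xₙ]` is connected to 1. -/
def ConnectedToOne (K : Type*) [Field K] (n : ℕ)
    (V : Submodule K (MvPolynomial (Fin n) K)) : Prop :=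
  V ≠ ⊥ ∧ ∀ e : ℕ,
    V ⊓ restrictTotalDegree (Fin n) K (e + 1) ≤
      restrictTotalDegree (Fin n) K 1 * (V ⊓ restrictTotalDegree (Fin n) K e)



theorem choose_le_card_expLE (n d : ℕ) : (n + d).choose n ≤ Fintype.card (ExpLE n d) := by
  have hsum : ∀ f ∈ Finset.finsuppAntidiag (Finset.univ : Finset (Option (Fin n))) d,
      f none + (f.some.sum fun _ e => e) = d := by
    intro f hf
    rw [Finset.mem_finsuppAntidiag] at hf
    rw [← hf.1, Fintype.sum_option, Finsupp.sum_fintype _ _ fun _ => rfl]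
    simp
  have hcard : (Finset.finsuppAntidiag (Finset.univ : Finset (Option (Fin n))) d).card =
      (n + d).choose n := by
    rw [Finset.card_finsuppAntidiag_nat_eq_choose, Nat.choose_symm_add]
    congr 1
    simp only [Finset.card_univ, Fintype.card_option, Fintype.card_fin]
    omega
  rw [← hcard, ← Fintype.card_coe]
  refine Fintype.card_le_of_injective
    (fun f => (⟨f.1.some, by have := hsum f.1 f.2; omega⟩ : ExpLE n d)) fun f g hfg => ?_
  have hs : f.1.some = g.1.some := congrArg Subtype.val hfg
  refine Subtype.ext (Finsupp.ext fun o => ?_)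
  cases o with
  | none =>
    have h1 := hsum f.1 f.2
    have h2 := hsum g.1 g.2
    rw [hs] at h1
    omega
  | some i => simpa using DFunLike.congr_fun hs i

/-- Affine-linear forms in `x₁,…,xₙ`. -/
noncomputable def affineForms (K : Type*) [Field K] (n : ℕ) :
    Submodule K (MvPolynomial (Fin n) K) :=
  Submodule.span K (Set.range fun o : Option (Fin n) => o.elim 1 X)

instance (K : Type*) [Field K] (n : ℕ) : FiniteDimensional K (affineForms K n) :=
  FiniteDimensional.span_of_finite K (Set.finite_range _)

theorem finrank_affineForms_le (K : Type*) [Field K] (n : ℕ) :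
    Module.finrank K (affineForms K n) ≤ n + 1 := by
  have h := finrank_range_le_card (R := K) fun o : Option (Fin n) =>
    (o.elim 1 X : MvPolynomial (Fin n) K)
  rwa [Fintype.card_option, Fintype.card_fin] at h

theorem one_mem_affineForms (K : Type*) [Field K] (n : ℕ) :
    (1 : MvPolynomial (Fin n) K) ∈ affineForms K n :=
  Submodule.subset_span ⟨none, rfl⟩

theorem X_mem_affineForms (K : Type*) [Field K] {n : ℕ} (i : Fin n) :
    (X i : MvPolynomial (Fin n) K) ∈ affineForms K n :=
  Submodule.subset_span ⟨some i, rfl⟩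

/-- The partial derivative with respect to `c_α`, evaluated at `c = 0`. -/
noncomputable def derivC (K : Type*) [Field K] (n d : ℕ) (α : ExpLE n d) :
    URing K n d →ₗ[K] MvPolynomial (Fin n) K :=
  (killC K n d).toLinearMap ∘ₗ (pderiv (Sum.inr α)).toLinearMap

section

variable {K : Type*} [Field K] {n d : ℕ}

@[simp]
theorem killC_X_inl (i : Fin n) : killC K n d (X (Sum.inl i)) = X i := by
  simp [killC]

@[simp]
theorem killC_X_inr (α : ExpLE n d) : killC K n d (X (Sum.inr α)) = 0 := by
  simp [killC]

theorem derivC_mul (α : ExpLE n d) (a b : URing K n d) :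
    derivC K n d α (a * b) =
      killC K n d a * derivC K n d α b + derivC K n d α a * killC K n d b := by
  simp [derivC, mul_comm]

@[simp]
theorem derivC_one (α : ExpLE n d) : derivC K n d α 1 = 0 := by
  simp [derivC]

@[simp]
theorem derivC_X_inl (α : ExpLE n d) (i : Fin n) : derivC K n d α (X (Sum.inl i)) = 0 := by
  simp [derivC]

@[simp]
theorem derivC_X_inr (α β : ExpLE n d) :
    derivC K n d α (X (Sum.inr β)) = if β = α then 1 else 0 := by
  simp [derivC, pderiv_X, Pi.single_apply]

theorem killC_genPoly : killC K n d (genPoly K n d) = 0 := by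
  simp [genPoly]

theorem derivC_genPoly (α : ExpLE n d) :
    derivC K n d α (genPoly K n d) = monomial α.1 1 := by
  simp [genPoly, derivC_mul, monomial_eq, Finsupp.prod_fintype]

theorem killC_mem_affineForms {a : URing K n d}
    (ha : a ∈ Submodule.span K (allowedMonomials K n d)) :
    killC K n d a ∈ affineForms K n := by
  suffices h : Submodule.span K (allowedMonomials K n d) ≤
      (affineForms K n).comap (killC K n d).toLinearMap from h ha
  refine Submodule.span_le.2 ?_
  rintro _ (((rfl | ⟨i, rfl⟩) | ⟨β, rfl⟩) | ⟨p, rfl⟩) <;>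
    simp [one_mem_affineForms, X_mem_affineForms]

theorem derivC_mem_affineForms (α : ExpLE n d) {a : URing K n d}
    (ha : a ∈ Submodule.span K (allowedMonomials K n d)) :
    derivC K n d α a ∈ affineForms K n := by
  suffices h : Submodule.span K (allowedMonomials K n d) ≤
      (affineForms K n).comap (derivC K n d α) from h ha
  refine Submodule.span_le.2 ?_
  rintro _ (((rfl | ⟨i, rfl⟩) | ⟨β, rfl⟩) | ⟨p, rfl⟩)
  · simp
  · simp
  · by_cases h : β = α <;> simp [h, one_mem_affineForms]
  · by_cases h : p.1 = α <;> simp [h, derivC_mul, X_mem_affineForms]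

end

section

variable {K : Type*} [Field K] {σ ι : Type*} [Fintype ι]

/-- If some entry of a column of the adjugate is nonzero, then all rows but the corresponding one
are linearly independent over the constants. -/
theorem linearIndependent_rows_of_adjugate_ne_zero [DecidableEq ι]
    (A : Matrix ι ι (MvPolynomial σ K))
    {j k : ι} (h : A.adjugate j k ≠ 0) :
    LinearIndependent K fun i : {i // i ≠ k} => A i.1 := by
  rw [Fintype.linearIndependent_iff]
  intro g hg
  by_contra! hne
  obtain ⟨i₀, hi₀⟩ := hne
  refine h ?_
  rw [Matrix.adjugate_apply, ← Matrix.exists_vecMul_eq_zero_iff]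
  refine ⟨fun i => if hi : i ≠ k then C (g ⟨i, hi⟩) else 0, fun h0 => hi₀ ?_, ?_⟩
  · have := congrFun h0 i₀.1
    simpa [i₀.2] using this
  · ext1 l
    have hl := congrFun hg l
    simp only [Finset.sum_apply, Pi.smul_apply, Pi.zero_apply, smul_eq_C_mul] at hl
    simp only [Matrix.vecMul, dotProduct, Pi.zero_apply]
    rw [← Fintype.sum_subtype_add_sum_subtype (fun i => i ≠ k), ← add_zero (0 : MvPolynomial σ K)]
    congr 1
    · rw [← hl]
      refine Finset.sum_congr rfl fun i _ => ?_
      simp [i.2]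
    · refine Finset.sum_eq_zero fun i _ => ?_
      simp [i.2]

/-- The map `(ℓ_j) ↦ ∑ ℓ_j f_j` on tuples from a subspace `W`. -/
noncomputable def combination (W : Submodule K (MvPolynomial σ K)) (f : ι → MvPolynomial σ K) :
    (ι → W) →ₗ[K] MvPolynomial σ K :=
  ∑ j, LinearMap.mulRight K (f j) ∘ₗ W.subtype ∘ₗ LinearMap.proj j

theorem combination_apply (W : Submodule K (MvPolynomial σ K)) (f : ι → MvPolynomial σ K)
    (l : ι → W) : combination W f l = ∑ j, (l j : MvPolynomial σ K) * f j := by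
  simp [combination]

end

/-- Theorem 4.5, sharpness part. If `M = M₀ + M₁` is a uniform
determinantal representation of `p_{n,d}` of size `N` whose constant part `M₀` is annihilated
on the left by a nonzero vector `u ∈ Kᴺ` (a compression space with one-dimensional witness),
then `N·(n+1) − (N−1) ≥ binom(n+d,n)`, i.e. `N·n + 1 ≥ binom(n+d,n)`. -/
theorem udr_compression_lower_bound (K : Type*) [Field K] (n d N : ℕ) (hn : 1 ≤ n)
    (M : Matrix (Fin N) (Fin N) (URing K n d)) (hM : IsUDR K n d N M)
    (u : Fin N → K) (hu : u ≠ 0)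
    (hcomp : Matrix.vecMul (fun i => (MvPolynomial.C (u i) : MvPolynomial (Fin n) K))
      (M.map (killC K n d)) = 0) :
    (n + d).choose n ≤ N * n + 1 := by
  obtain ⟨k, hk⟩ : ∃ k, u k ≠ 0 := Function.ne_iff.1 hu
  set A := M.map (killC K n d) with hA
  set f : Fin N → MvPolynomial (Fin n) K := fun j => A.adjugate j k with hf
  set Φ := combination (affineForms K n) f with hΦ
  set r : Fin N → URing K n d := Matrix.vecMul (fun i => C (u i)) M with hr
  have hr_mem : ∀ j, r j ∈ Submodule.span K (allowedMonomials K n d) := by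
    intro j
    simp only [hr, Matrix.vecMul, dotProduct, ← smul_eq_C_mul]
    exact Submodule.sum_mem _ fun i _ => Submodule.smul_mem _ _ (hM.1 i j)
  have hr_kill : ∀ j, killC K n d (r j) = 0 := by
    intro j
    have := congrFun hcomp j
    simpa [hr, Matrix.vecMul, dotProduct, hA, ← algebraMap_eq] using this
  have hadj : ∀ j, killC K n d (M.adjugate j k) = f j := by
    intro j
    have := congrFun (congrFun ((killC K n d).map_adjugate M) j) k
    simpa [hf, hA] using this
  have hexp : u k • genPoly K n d = ∑ j, r j * M.adjugate j k := by
    have h : Matrix.vecMul r M.adjugate k = u k • genPoly K n d := by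
      rw [hr, Matrix.vecMul_vecMul, Matrix.mul_adjugate, hM.2, Matrix.vecMul_smul,
        Matrix.vecMul_one, Pi.smul_apply, smul_eq_C_mul, smul_eq_mul, mul_comm]
    rw [← h]
    rfl
  have hrange : ∀ α : ExpLE n d, monomial α.1 (1 : K) ∈ LinearMap.range Φ := by
    intro α
    have h := congrArg (derivC K n d α) hexp
    rw [map_smul, derivC_genPoly, map_sum] at h
    simp only [derivC_mul, hr_kill, hadj, zero_mul, zero_add] at h
    refine (Submodule.smul_mem_iff _ hk).1 ?_
    exact ⟨fun j => ⟨_, derivC_mem_affineForms α (hr_mem j)⟩, by rw [hΦ, combination_apply, h]⟩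
  have hrank_range : (n + d).choose n ≤ Module.finrank K (LinearMap.range Φ) := by
    refine (choose_le_card_expLE n d).trans ?_
    have hli : LinearIndependent K fun α : ExpLE n d => monomial α.1 (1 : K) := by
      have := (basisMonomials (Fin n) K).linearIndependent.comp
        (Subtype.val : ExpLE n d → _) Subtype.val_injective
      rw [coe_basisMonomials] at this
      exact this
    exact (LinearIndependent.of_comp (v := fun α : ExpLE n d =>
      (⟨_, hrange α⟩ : LinearMap.range Φ)) (LinearMap.range Φ).subtype hli).fintype_card_le_finrank
  obtain ⟨j₀, hj₀⟩ : ∃ j, f j ≠ 0 := by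
    by_contra! h0
    obtain ⟨l, hl⟩ := hrange ⟨0, by simp⟩
    rw [hΦ, combination_apply] at hl
    simp [h0] at hl
  have hker : ∀ i, (fun j => ⟨A i j, killC_mem_affineForms (hM.1 i j)⟩) ∈ LinearMap.ker Φ := by
    intro i
    rw [LinearMap.mem_ker, hΦ, combination_apply]
    have hdet : A.det = 0 := by
      rw [← killC_genPoly (K := K) (n := n) (d := d), ← hM.2, AlgHom.map_det]
      rfl
    have h := congrFun (congrFun (Matrix.mul_adjugate A) i) k
    rw [hdet, zero_smul] at h
    exact h
  have hrank_ker : N - 1 ≤ Module.finrank K (LinearMap.ker Φ) := by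
    have hli := linearIndependent_rows_of_adjugate_ne_zero A hj₀
    have h := (LinearIndependent.of_comp
      (v := fun i : {i // i ≠ k} => (⟨_, hker i.1⟩ : LinearMap.ker Φ))
      ((affineForms K n).subtype.compLeft (Fin N) ∘ₗ (LinearMap.ker Φ).subtype)
      hli).fintype_card_le_finrank
    simpa [Fintype.card_subtype_compl] using h
  have hdim : Module.finrank K (Fin N → affineForms K n) ≤ N * (n + 1) := by
    rw [Module.finrank_pi_fintype]
    simpa using Nat.mul_le_mul_left N (finrank_affineForms_le K n)
  have hrn := Φ.finrank_range_add_finrank_ker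
  have hN : 0 < N := k.pos
  rw [Nat.mul_succ] at hdim
  omega
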